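/- arXiv:1108.3685 — 2 statements merged into one kernel-verified Lean document; each statement's English description precedes it below -/
import Mathlib

section
/- Let K = (k(1),...,k(n)) ∈ ℕ^n with k(1) + ... + k(n-1) > 0, and d^K = ∏_{i=1}^{n} d_{n,i}^{k(i)}. Then there exist a finite composite P of Steenrod operations of the form P^{p^s} (s ∈ ℕ), a tuple L = (l(1),...,l(n)) ∈ ℕ^n, and a unit u ∈ F_p^× such that P(d^K) = u · d^L, where l(n) > k(n), l(i) < k(i) for some i < n, and l(t) = k(t) for every t ∉ {i, n}. -/
open MvPolynomial Matrix

/-- The algebra automorphism of `F_p[y_1,...,y_n]` induced by `g ∈ GL_n(F_p)`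
(linear substitution of the variables: `y_i ↦ ∑_j g_{j i} y_j`). -/
noncomputable def glAct (p n : ℕ) (g : GL (Fin n) (ZMod p)) :
    MvPolynomial (Fin n) (ZMod p) →ₐ[ZMod p] MvPolynomial (Fin n) (ZMod p) :=
  aeval fun i => ∑ j, C ((g : Matrix (Fin n) (Fin n) (ZMod p)) j i) * X j

/-- The total Steenrod operation `P_t`, the algebra homomorphism with
`P_t(y_i) = y_i + y_i^p t`. -/
noncomputable def Pt (p n : ℕ) :
    MvPolynomial (Fin n) (ZMod p) →ₐ[ZMod p] Polynomial (MvPolynomial (Fin n) (ZMod p)) :=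
  aeval fun i => Polynomial.C (X i) + Polynomial.C (X i ^ p) * Polynomial.X

/-- The Steenrod operation `P^k`: the coefficient of `t^k` in `P_t(f)`. -/
noncomputable def steenrod (p n k : ℕ) (f : MvPolynomial (Fin n) (ZMod p)) :
    MvPolynomial (Fin n) (ZMod p) :=
  (Pt p n f).coeff k

/-- The Dickson invariant `d_{n,i}`, defined from the identity
`∏_{v ∈ F_p^n} (X + v·y) = ∑_{i=0}^n (-1)^i d_{n,i} X^{p^{n-i}}`. -/
noncomputable def dickson (p n i : ℕ) [NeZero p] : MvPolynomial (Fin n) (ZMod p) :=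
  (-1) ^ i *
    (∏ v : Fin n → ZMod p,
      (Polynomial.X + Polynomial.C (∑ j, C (v j) * X j))).coeff (p ^ (n - i))

/-- The iterated Steenrod operation `P(c,j) = P^{p^{c-j+1}} ∘ ⋯ ∘ P^{p^{c-1}} ∘ P^{p^c}`
(`P^{p^c}` applied first). -/
noncomputable def Pcj (p n c : ℕ) : ℕ → MvPolynomial (Fin n) (ZMod p) → MvPolynomial (Fin n) (ZMod p)
  | 0 => id
  | j + 1 => fun f => steenrod p n (p ^ (c + 1 - (j + 1))) (Pcj p n c j f)

/-- Apply the composite `P^{p^{s_1}} ∘ P^{p^{s_2}} ∘ ⋯ ∘ P^{p^{s_r}}` (last entry applied first). -/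
noncomputable def steenrodList (p n : ℕ) :
    List ℕ → MvPolynomial (Fin n) (ZMod p) → MvPolynomial (Fin n) (ZMod p)
  | [] => id
  | s :: rest => fun f => steenrod p n (p ^ s) (steenrodList p n rest f)

section DicksonPolynomial

theorem prod_X_add_C_zmod (p : ℕ) [Fact p.Prime] :
    ∏ a : ZMod p, (Polynomial.X + Polynomial.C a) = (Polynomial.X ^ p - Polynomial.X) := by
  have hp := (Fact.out : p.Prime).one_lt
  have hm : (Polynomial.X ^ p - Polynomial.X : Polynomial (ZMod p)).Monic :=
    Polynomial.monic_X_pow_sub (by simpa using hp)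
  have hr : (Polynomial.X ^ p - Polynomial.X : Polynomial (ZMod p)).roots =
      Finset.univ.val := by
    simpa [ZMod.card] using FiniteField.roots_X_pow_card_sub_X (ZMod p)
  rw [← Polynomial.prod_multiset_X_sub_C_of_monic_of_roots_card_eq hm (by
    rw [hr, FiniteField.X_pow_card_sub_X_natDegree_eq _ hp]; simp [ZMod.card]), hr]
  change _ = ∏ a : ZMod p, (Polynomial.X - Polynomial.C a)
  rw [← Equiv.prod_comp (Equiv.neg (ZMod p)) fun a => (Polynomial.X - Polynomial.C a)]
  simp

variable {p : ℕ} [Fact p.Prime] {R : Type*} [CommRing R]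

/-- The `R`-module of `p`-polynomials, spanned by the monomials `X ^ p ^ k`. -/
noncomputable def pPolynomials (p : ℕ) (R : Type*) [CommRing R] : Submodule R (Polynomial R) :=
  Submodule.span R (Set.range fun k : ℕ => (Polynomial.X : Polynomial R) ^ p ^ k)

theorem aeval_add_mul_of_mem_pPolynomials {T : Type*} [CommRing T] [Algebra R T]
    [Algebra (ZMod p) T] {Q : Polynomial R} (hQ : Q ∈ pPolynomials p R) (x y : T) (a : ZMod p) :
    Polynomial.aeval (x + algebraMap (ZMod p) T a * y) Q =
      Polynomial.aeval x Q + algebraMap (ZMod p) T a * Polynomial.aeval y Q := by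
  cases subsingleton_or_nontrivial T
  · exact Subsingleton.elim _ _
  have : CharP T p := charP_of_injective_algebraMap (algebraMap (ZMod p) T).injective p
  induction hQ using Submodule.span_induction with
  | mem Q h =>
    obtain ⟨k, rfl⟩ := h
    simp only [map_pow, Polynomial.aeval_X]
    rw [add_pow_char_pow, mul_pow, ← map_pow, ZMod.pow_card_pow]
  | zero => simp
  | add f g _ _ hf hg => rw [map_add, hf, hg, map_add, map_add]; ring
  | smul c f _ hf => rw [map_smul, hf, map_smul, map_smul, smul_add, mul_smul_comm]

theorem coeff_pow_char [CharP R p] (Q : Polynomial R) (k : ℕ) :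
    (Q ^ p).coeff (p ^ (k + 1)) = Q.coeff (p ^ k) ^ p := by
  rw [← Polynomial.map_frobenius_expand, Polynomial.coeff_map, pow_succ,
    Polynomial.coeff_expand_mul (Fact.out : p.Prime).pos, frobenius_def]

theorem coeff_one_pow_char [CharP R p] (Q : Polynomial R) : (Q ^ p).coeff 1 = 0 := by
  rw [← Polynomial.map_frobenius_expand, Polynomial.coeff_map,
    Polynomial.coeff_expand (Fact.out : p.Prime).pos,
    if_neg (by simpa using (Fact.out : p.Prime).ne_one), map_zero]

variable [Algebra (ZMod p) R]

theorem prod_add_algebraMap_mul [IsDomain R] (Z W : R) :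
    ∏ a : ZMod p, (Z + algebraMap (ZMod p) R a * W) = Z ^ p - Z * W ^ (p - 1) := by
  have hp : 0 < p - 1 := Nat.sub_pos_of_lt (Fact.out : p.Prime).one_lt
  by_cases hW : W = 0
  · simp [hW, hp.ne', ZMod.card]
  · apply IsFractionRing.injective R (FractionRing R)
    have hW' : algebraMap R (FractionRing R) W ≠ 0 := by simpa using hW
    have key := congrArg
      (Polynomial.aeval (algebraMap R (FractionRing R) Z / algebraMap R (FractionRing R) W))
      (prod_X_add_C_zmod p)
    simp only [map_prod, map_add, map_sub, map_pow, Polynomial.aeval_X, Polynomial.aeval_C] at key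
    have h (a : ZMod p) : algebraMap R (FractionRing R) (Z + algebraMap (ZMod p) R a * W) =
        algebraMap R (FractionRing R) W *
          (algebraMap R (FractionRing R) Z / algebraMap R (FractionRing R) W +
            algebraMap (ZMod p) (FractionRing R) a) := by
      rw [IsScalarTower.algebraMap_apply (ZMod p) R (FractionRing R), map_add, map_mul]
      field_simp
    rw [map_prod, Finset.prod_congr rfl fun a _ => h a, Finset.prod_mul_distrib, key]
    obtain ⟨q, hq⟩ : ∃ q, p = q + 1 := ⟨p - 1, by omega⟩
    simp only [Finset.prod_const, Finset.card_univ, ZMod.card, map_sub, map_mul, map_pow, div_pow,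
      mul_sub, mul_div_cancel₀ _ (pow_ne_zero p hW')]
    congr 1
    rw [← mul_div_assoc, div_eq_iff hW', hq, Nat.add_sub_cancel]
    ring

/-- The product of the linear forms `X + ∑ v_j y_j` over all `v ∈ F_p^n`. -/
noncomputable def linearFormProd (p : ℕ) [Fact p.Prime] {R : Type*} [CommRing R]
    [Algebra (ZMod p) R] {n : ℕ} (y : Fin n → R) : Polynomial R :=
  ∏ v : Fin n → ZMod p,
    (Polynomial.X + Polynomial.C (∑ j, algebraMap (ZMod p) R (v j) * y j))

theorem pow_mem_pPolynomials [Nontrivial R] {Q : Polynomial R} (hQ : Q ∈ pPolynomials p R) :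
    Q ^ p ∈ pPolynomials p R := by
  have : CharP R p := charP_of_injective_algebraMap (algebraMap (ZMod p) R).injective p
  induction hQ using Submodule.span_induction with
  | mem Q h =>
    obtain ⟨k, rfl⟩ := h
    exact Submodule.subset_span ⟨k + 1, by simp [← pow_mul, pow_succ]⟩
  | zero => simp [(Fact.out : p.Prime).ne_zero]
  | add f g _ _ hf hg => rw [add_pow_char]; exact add_mem hf hg
  | smul c f _ hf => rw [smul_pow]; exact Submodule.smul_mem _ _ hf

theorem linearFormProd_cons_of_mem [IsDomain R] {n : ℕ} (z : R) (y : Fin n → R)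
    (hy : linearFormProd p y ∈ pPolynomials p R) :
    linearFormProd p (Fin.cons z y : Fin (n + 1) → R) =
      linearFormProd p y ^ p -
        linearFormProd p y * Polynomial.C ((linearFormProd p y).eval z) ^ (p - 1) := by
  rw [← prod_add_algebraMap_mul]
  have h (a : ZMod p) : linearFormProd p y +
      algebraMap (ZMod p) _ a * Polynomial.C ((linearFormProd p y).eval z) =
      ∏ v : Fin n → ZMod p, (Polynomial.X + Polynomial.C
        (algebraMap (ZMod p) R a * z + ∑ j, algebraMap (ZMod p) R (v j) * y j)) := by
    have := aeval_add_mul_of_mem_pPolynomials hy (Polynomial.X : Polynomial R) (Polynomial.C z) a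
    rw [Polynomial.aeval_X_left_apply, ← Polynomial.algebraMap_eq,
      Polynomial.aeval_algebraMap_apply, Polynomial.coe_aeval_eq_eval, Polynomial.algebraMap_eq] at this
    rw [← this, linearFormProd, map_prod]
    refine Finset.prod_congr rfl fun v _ => ?_
    rw [map_add, Polynomial.aeval_X, Polynomial.aeval_C, Polynomial.algebraMap_eq,
      IsScalarTower.algebraMap_apply (ZMod p) R (Polynomial R), Polynomial.algebraMap_eq,
      map_add, map_mul]
    ring
  simp_rw [h]
  rw [linearFormProd, ← (Fin.consEquiv fun _ : Fin (n + 1) => ZMod p).prod_comp,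
    Fintype.prod_prod_type]
  simp [Fin.consEquiv, Fin.sum_univ_succ]

theorem linearFormProd_mem_pPolynomials [IsDomain R] {n : ℕ} (y : Fin n → R) :
    linearFormProd p y ∈ pPolynomials p R := by
  induction n with
  | zero => exact Submodule.subset_span ⟨0, by simp [linearFormProd]⟩
  | succ n ih =>
    rw [← Fin.cons_self_tail y, linearFormProd_cons_of_mem _ _ (ih _), ← map_pow, mul_comm,
      ← Polynomial.smul_eq_C_mul]
    exact sub_mem (pow_mem_pPolynomials (ih _)) (Submodule.smul_mem _ _ (ih _))

theorem linearFormProd_cons [IsDomain R] {n : ℕ} (z : R) (y : Fin n → R) :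
    linearFormProd p (Fin.cons z y : Fin (n + 1) → R) =
      linearFormProd p y ^ p -
        linearFormProd p y * Polynomial.C ((linearFormProd p y).eval z) ^ (p - 1) :=
  linearFormProd_cons_of_mem z y (linearFormProd_mem_pPolynomials y)

theorem exists_linearFormProd_comp [IsDomain R] (t : R) {n : ℕ} (y : Fin n → R) :
    ∃ a : R, (linearFormProd p fun i => y i + t * y i ^ p).comp
        (Polynomial.X + Polynomial.C t * Polynomial.X ^ p) =
      Polynomial.C a * linearFormProd p y +
        Polynomial.C (t ^ p ^ n) * linearFormProd p y ^ p := by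
  have : CharP R p := charP_of_injective_algebraMap (algebraMap (ZMod p) R).injective p
  induction n with
  | zero => exact ⟨1, by simp [linearFormProd]⟩
  | succ n ih =>
    obtain ⟨z, y, rfl⟩ : ∃ z x, y = Fin.cons z x := ⟨_, _, (Fin.cons_self_tail y).symm⟩
    obtain ⟨a, ha⟩ := ih y
    have hz := congrArg (Polynomial.eval z) ha
    have hcons : (fun i => (Fin.cons z y : Fin (n + 1) → R) i +
        t * (Fin.cons z y : Fin (n + 1) → R) i ^ p) =
        Fin.cons (z + t * z ^ p) (fun i => y i + t * y i ^ p) := by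
      funext i
      refine Fin.cases ?_ (fun j => ?_) i <;> simp
    rw [hcons, linearFormProd_cons, linearFormProd_cons]
    simp only [Polynomial.eval_comp, Polynomial.eval_add, Polynomial.eval_mul, Polynomial.eval_X,
      Polynomial.eval_C, Polynomial.eval_pow] at hz
    set w := (linearFormProd p y).eval z
    refine ⟨a * (a + t ^ p ^ n * w ^ (p - 1)) ^ (p - 1), ?_⟩
    simp only [Polynomial.sub_comp, Polynomial.mul_comp, Polynomial.pow_comp, Polynomial.C_comp]
    rw [ha, hz]
    obtain ⟨q, hq⟩ : ∃ q, p = q + 1 := ⟨p - 1, by have := (Fact.out : p.Prime).pos; omega⟩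
    set U := linearFormProd p y
    have e1 : (Polynomial.C a * U + Polynomial.C (t ^ p ^ n) * U ^ p) ^ p =
        Polynomial.C a ^ p * U ^ p + Polynomial.C (t ^ p ^ n) ^ p * (U ^ p) ^ p := by
      rw [add_pow_char, mul_pow, mul_pow]
    have e2 : (U ^ p - U * Polynomial.C w ^ (p - 1)) ^ p =
        (U ^ p) ^ p - U ^ p * (Polynomial.C w ^ (p - 1)) ^ p := by
      rw [sub_pow_char, mul_pow]
    have e3 : (Polynomial.C a + Polynomial.C (t ^ p ^ n) * Polynomial.C w ^ (p - 1)) ^ p =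
        Polynomial.C a ^ p + Polynomial.C (t ^ p ^ n) ^ p * (Polynomial.C w ^ (p - 1)) ^ p := by
      rw [add_pow_char, mul_pow]
    have e4 : (a * w + t ^ p ^ n * w ^ p) = w * (a + t ^ p ^ n * w ^ (p - 1)) := by
      have : w ^ p = w * w ^ (p - 1) := by rw [← pow_succ']; congr 1; omega
      rw [this]; ring
    have e5 (x : Polynomial R) : x ^ p = x * x ^ (p - 1) := by
      rw [← pow_succ']; congr 1; omega
    have e6 : t ^ p ^ (n + 1) = (t ^ p ^ n) ^ p := by rw [← pow_mul, ← pow_succ]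
    rw [e1, e2, e4, e6]
    rw [e5 (_ + _)] at e3
    simp only [map_mul, map_add, map_pow, mul_pow] at e3 ⊢
    linear_combination (- U ^ p) * e3

theorem coeff_comp_of_mem_pPolynomials {Q : Polynomial R} [Nontrivial R]
    (hQ : Q ∈ pPolynomials p R) (t : R) (k : ℕ) :
    (Q.comp (Polynomial.X + Polynomial.C t * Polynomial.X ^ p)).coeff (p ^ (k + 1)) =
      Q.coeff (p ^ (k + 1)) + t ^ p ^ k * Q.coeff (p ^ k) := by
  have : CharP R p := charP_of_injective_algebraMap (algebraMap (ZMod p) R).injective p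
  induction hQ using Submodule.span_induction with
  | mem Q h =>
    obtain ⟨l, rfl⟩ := h
    have hi := Nat.pow_right_injective (Fact.out : p.Prime).two_le
    have h1 (a b : ℕ) : p ^ a = p ^ b ↔ a = b := hi.eq_iff
    have h2 : (Polynomial.X ^ p ^ l : Polynomial R).comp
        (Polynomial.X + Polynomial.C t * Polynomial.X ^ p) =
        Polynomial.X ^ p ^ l + Polynomial.C (t ^ p ^ l) * Polynomial.X ^ p ^ (l + 1) := by
      rw [Polynomial.X_pow_comp, add_pow_char_pow, mul_pow, ← pow_mul, ← pow_succ', map_pow]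
    simp only [h2, Polynomial.coeff_add, Polynomial.coeff_C_mul, Polynomial.coeff_X_pow, h1]
    by_cases h : k = l <;> simp [h]
  | zero => simp
  | add f g _ _ hf hg => simp only [Polynomial.add_comp, Polynomial.coeff_add, hf, hg]; ring
  | smul c f _ hf =>
    simp only [Polynomial.smul_comp, Polynomial.coeff_smul, hf, smul_eq_mul]; ring

theorem coeff_one_comp_of_mem_pPolynomials {Q : Polynomial R} [Nontrivial R]
    (hQ : Q ∈ pPolynomials p R) (t : R) :
    (Q.comp (Polynomial.X + Polynomial.C t * Polynomial.X ^ p)).coeff 1 = Q.coeff 1 := by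
  have : CharP R p := charP_of_injective_algebraMap (algebraMap (ZMod p) R).injective p
  induction hQ using Submodule.span_induction with
  | mem Q h =>
    obtain ⟨l, rfl⟩ := h
    have h2 : (Polynomial.X ^ p ^ l : Polynomial R).comp
        (Polynomial.X + Polynomial.C t * Polynomial.X ^ p) =
        Polynomial.X ^ p ^ l + Polynomial.C (t ^ p ^ l) * Polynomial.X ^ p ^ (l + 1) := by
      rw [Polynomial.X_pow_comp, add_pow_char_pow, mul_pow, ← pow_mul, ← pow_succ', map_pow]
    have h3 : 1 ≠ p ^ (l + 1) := (Nat.one_lt_pow l.succ_ne_zero (Fact.out : p.Prime).one_lt).ne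
    simp only [h2, Polynomial.coeff_add, Polynomial.coeff_C_mul, Polynomial.coeff_X_pow, if_neg h3]
    simp
  | zero => simp
  | add f g _ _ hf hg => simp only [Polynomial.add_comp, Polynomial.coeff_add, hf, hg]
  | smul c f _ hf => simp only [Polynomial.smul_comp, Polynomial.coeff_smul, hf]

theorem linearFormProd_coeff_card [Nontrivial R] {n : ℕ} (y : Fin n → R) :
    (linearFormProd p y).coeff (p ^ n) = 1 := by
  have h : (linearFormProd p y).Monic :=
    Polynomial.monic_prod_of_monic _ _ fun v _ => Polynomial.monic_X_add_C _
  have hd : (linearFormProd p y).natDegree = p ^ n := by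
    rw [linearFormProd, Polynomial.natDegree_prod_of_monic _ _ fun v _ =>
      Polynomial.monic_X_add_C _]
    simp only [Polynomial.natDegree_X_add_C]
    simp [ZMod.card]
  rw [← hd]
  exact h

theorem linearFormProd_map {S : Type*} [CommRing S] [Algebra (ZMod p) S] (f : R →ₐ[ZMod p] S)
    {n : ℕ} (y : Fin n → R) :
    (linearFormProd p y).map (f : R →+* S) = linearFormProd p fun i => f (y i) := by
  simp [linearFormProd, Polynomial.map_prod, Polynomial.map_sum]

end DicksonPolynomial

section DicksonInvariants

variable {p : ℕ} [Fact p.Prime] {n : ℕ}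

theorem dickson_eq (i : ℕ) : dickson p n i =
    (-1) ^ i * (linearFormProd p (X : Fin n → MvPolynomial (Fin n) (ZMod p))).coeff
      (p ^ (n - i)) := rfl

theorem dickson_zero : dickson p n 0 = 1 := by
  simp [dickson_eq, linearFormProd_coeff_card]

/-- The recursion satisfied by the total Steenrod operation on the Dickson invariants. -/
theorem exists_Pt_dickson (p n : ℕ) [Fact p.Prime] :
    ∃ a : Polynomial (MvPolynomial (Fin n) (ZMod p)),
    Pt p n (dickson p n n) = a * Polynomial.C (dickson p n n) ∧
    ∀ i < n, Pt p n (dickson p n i) -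
        Polynomial.X ^ p ^ (n - i - 1) * Pt p n (dickson p n (i + 1)) =
      a * Polynomial.C (dickson p n i) -
        Polynomial.X ^ p ^ n * Polynomial.C (dickson p n (i + 1) ^ p) := by
  set S := Polynomial (MvPolynomial (Fin n) (ZMod p))
  set y : Fin n → MvPolynomial (Fin n) (ZMod p) := X
  have : CharP S p := charP_of_injective_algebraMap (algebraMap (ZMod p) S).injective p
  obtain ⟨a, ha⟩ := exists_linearFormProd_comp (p := p) (Polynomial.X : S) (fun i => Polynomial.C (y i))
  have h1 : (linearFormProd p fun i => (Polynomial.C (y i) : S) +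
      Polynomial.X * Polynomial.C (y i) ^ p) =
      (linearFormProd p y).map (Pt p n : _ →+* S) := by
    rw [linearFormProd_map]
    congr 1
    funext i
    simp only [Pt, y, aeval_X, map_pow]
    ring
  have h2 : (linearFormProd p fun i => (Polynomial.C (y i) : S)) =
      (linearFormProd p y).map (Polynomial.C : _ →+* S) :=
    (linearFormProd_map (IsScalarTower.toAlgHom (ZMod p) (MvPolynomial (Fin n) (ZMod p)) S)
      y).symm
  have hmem := linearFormProd_mem_pPolynomials (p := p) fun i => (Polynomial.C (y i) : S) +
      Polynomial.X * Polynomial.C (y i) ^ p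
  have hc0 := coeff_one_comp_of_mem_pPolynomials hmem (Polynomial.X : S)
  have hc := coeff_comp_of_mem_pPolynomials hmem (Polynomial.X : S)
  rw [ha] at hc hc0
  rw [h1, h2] at hc hc0
  simp only [Polynomial.coeff_add, Polynomial.coeff_C_mul, coeff_pow_char, coeff_one_pow_char,
    Polynomial.coeff_map, mul_zero, add_zero] at hc hc0
  refine ⟨a, ?_, fun i hi => ?_⟩
  · rw [dickson_eq, Nat.sub_self, pow_zero, map_mul, map_mul]
    simp only [map_pow, map_neg, map_one]
    simp only [RingHom.coe_coe, y] at hc0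
    linear_combination (-(-1) ^ n) * hc0
  · have hk := hc (n - i - 1)
    have e1 : n - i - 1 + 1 = n - i := by omega
    have hodd : ((-1 : S) ^ (i + 1)) ^ p = (-1) ^ (i + 1) := by
      rw [← pow_mul, mul_comm, pow_mul, neg_one_pow_char]
    rw [e1] at hk
    rw [dickson_eq, dickson_eq, ← Nat.sub_sub]
    simp only [map_mul, map_pow, map_neg, map_one, mul_pow, hodd]
    simp only [RingHom.coe_coe] at hk
    linear_combination (-(-1) ^ i) * hk

end DicksonInvariants

section SteenrodOperations

variable {p : ℕ} [Fact p.Prime] {n : ℕ}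

theorem steenrod_add (k : ℕ) (f g : MvPolynomial (Fin n) (ZMod p)) :
    steenrod p n k (f + g) = steenrod p n k f + steenrod p n k g := by
  simp [steenrod]

theorem steenrod_smul (k : ℕ) (a : ZMod p) (f : MvPolynomial (Fin n) (ZMod p)) :
    steenrod p n k (a • f) = a • steenrod p n k f := by
  simp [steenrod]

theorem steenrod_zero_left (f : MvPolynomial (Fin n) (ZMod p)) : steenrod p n 0 f = f := by
  have h : (Polynomial.aeval (0 : MvPolynomial (Fin n) (ZMod p))).toRingHom.comp
      (Pt p n : _ →+* Polynomial (MvPolynomial (Fin n) (ZMod p))) = RingHom.id _ := by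
    apply MvPolynomial.ringHom_ext
    · intro a
      simp
    · intro i
      simp [Pt]
  rw [steenrod, Polynomial.coeff_zero_eq_aeval_zero]
  exact RingHom.congr_fun h f

theorem steenrod_mul (k : ℕ) (f g : MvPolynomial (Fin n) (ZMod p)) :
    steenrod p n k (f * g) =
      ∑ x ∈ Finset.HasAntidiagonal.antidiagonal k, steenrod p n x.1 f * steenrod p n x.2 g := by
  simp [steenrod, Polynomial.coeff_mul]

theorem steenrod_pow_char_pow_mul (r k : ℕ) (f : MvPolynomial (Fin n) (ZMod p)) :
    steenrod p n (k * p ^ r) (f ^ p ^ r) = steenrod p n k f ^ p ^ r := by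
  rw [steenrod, map_pow, ← Polynomial.map_iterateFrobenius_expand, Polynomial.coeff_map,
    Polynomial.coeff_expand_mul (pow_pos (Fact.out : p.Prime).pos r), iterateFrobenius_def]
  rfl

theorem steenrod_pow_char_pow_of_not_dvd {r k : ℕ} (h : ¬ p ^ r ∣ k)
    (f : MvPolynomial (Fin n) (ZMod p)) : steenrod p n k (f ^ p ^ r) = 0 := by
  rw [steenrod, map_pow, ← Polynomial.map_iterateFrobenius_expand, Polynomial.coeff_map,
    Polynomial.coeff_expand (pow_pos (Fact.out : p.Prime).pos r), if_neg h, map_zero]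

theorem exists_steenrod_pow_char_pow (r k : ℕ) (f : MvPolynomial (Fin n) (ZMod p)) :
    ∃ g, steenrod p n k (f ^ p ^ r) = g ^ p ^ r := by
  by_cases h : p ^ r ∣ k
  · obtain ⟨m, rfl⟩ := h
    exact ⟨_, by rw [mul_comm, steenrod_pow_char_pow_mul]⟩
  · exact ⟨0, by
      rw [steenrod_pow_char_pow_of_not_dvd h, zero_pow (pow_ne_zero r (Fact.out : p.Prime).ne_zero)]⟩

/-- All Steenrod operations of degree strictly between `0` and `p ^ c` vanish on `f`. -/
def SteenrodInert (p n c : ℕ) (f : MvPolynomial (Fin n) (ZMod p)) : Prop :=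
  ∀ k, 0 < k → k < p ^ c → steenrod p n k f = 0

theorem SteenrodInert.mono {c d : ℕ} {f : MvPolynomial (Fin n) (ZMod p)}
    (hf : SteenrodInert p n d f) (h : c ≤ d) : SteenrodInert p n c f :=
  fun k h0 hk => hf k h0 (hk.trans_le (Nat.pow_le_pow_right (Fact.out : p.Prime).pos h))

theorem SteenrodInert.steenrod_eq_zero {c d : ℕ} {f : MvPolynomial (Fin n) (ZMod p)}
    (hf : SteenrodInert p n d f) (h : c < d) : steenrod p n (p ^ c) f = 0 :=
  hf _ (pow_pos (Fact.out : p.Prime).pos c) (Nat.pow_lt_pow_right (Fact.out : p.Prime).one_lt h)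

theorem steenrodInert_one {p n : ℕ} (c : ℕ) : SteenrodInert p n c 1 := by
  intro k h0 _
  simp [steenrod, Polynomial.coeff_one, h0.ne']

theorem SteenrodInert.mul {c : ℕ} {f g : MvPolynomial (Fin n) (ZMod p)}
    (hf : SteenrodInert p n c f) (hg : SteenrodInert p n c g) : SteenrodInert p n c (f * g) := by
  intro k h0 hk
  rw [steenrod_mul]
  refine Finset.sum_eq_zero fun x hx => ?_
  rw [Finset.HasAntidiagonal.mem_antidiagonal] at hx
  by_cases h1 : x.1 = 0
  · rw [hg x.2 (by omega) (by omega), mul_zero]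
  · rw [hf x.1 (by omega) (by omega), zero_mul]

theorem SteenrodInert.pow {c : ℕ} {f : MvPolynomial (Fin n) (ZMod p)}
    (hf : SteenrodInert p n c f) (m : ℕ) : SteenrodInert p n c (f ^ m) := by
  induction m with
  | zero => simpa using steenrodInert_one c
  | succ m ih => rw [pow_succ]; exact ih.mul hf

theorem SteenrodInert.smul {c : ℕ} {f : MvPolynomial (Fin n) (ZMod p)}
    (hf : SteenrodInert p n c f) (a : ZMod p) : SteenrodInert p n c (a • f) := by
  intro k h0 hk
  rw [steenrod_smul, hf k h0 hk, smul_zero]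

/-- `P^{p^c}` satisfies the Leibniz rule on products with an inert factor. -/
theorem SteenrodInert.steenrod_mul {c : ℕ} {f : MvPolynomial (Fin n) (ZMod p)}
    (hf : SteenrodInert p n c f) (g : MvPolynomial (Fin n) (ZMod p)) :
    steenrod p n (p ^ c) (f * g) =
      steenrod p n (p ^ c) f * g + f * steenrod p n (p ^ c) g := by
  have hpos : 0 < p ^ c := pow_pos (Fact.out : p.Prime).pos c
  rw [_root_.steenrod_mul, ← Finset.sum_subset
    (s₁ := {(p ^ c, 0), (0, p ^ c)}) (by intro x; aesop)]
  · rw [Finset.sum_pair fun h => hpos.ne' (congrArg Prod.fst h), steenrod_zero_left, steenrod_zero_left]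
  · intro x hx hx'
    rw [Finset.HasAntidiagonal.mem_antidiagonal] at hx
    obtain ⟨a, b⟩ := x
    simp only [Finset.mem_insert, Finset.mem_singleton, Prod.mk.injEq, not_or] at hx' hx
    rw [hf a (by omega) (by omega), zero_mul]

theorem SteenrodInert.steenrod_pow {c : ℕ} {f : MvPolynomial (Fin n) (ZMod p)}
    (hf : SteenrodInert p n c f) (m : ℕ) :
    steenrod p n (p ^ c) (f ^ (m + 1)) =
      ((m + 1 : ℕ) : ZMod p) • (f ^ m * steenrod p n (p ^ c) f) := by
  rw [Nat.cast_smul_eq_nsmul, nsmul_eq_mul]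
  induction m with
  | zero => simp
  | succ m ih =>
    rw [pow_succ, (hf.pow _).steenrod_mul, ih]
    push_cast
    ring

theorem SteenrodInert.pow_char_pow {c : ℕ} {f : MvPolynomial (Fin n) (ZMod p)}
    (hf : SteenrodInert p n c f) (r : ℕ) : SteenrodInert p n (r + c) (f ^ p ^ r) := by
  intro k h0 hk
  by_cases h : p ^ r ∣ k
  · obtain ⟨m, rfl⟩ := h
    have hr : 0 < p ^ r := pow_pos (Fact.out : p.Prime).pos r
    rw [mul_comm, steenrod_pow_char_pow_mul, hf m (pos_of_mul_pos_right h0 hr.le)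
      (by rw [pow_add] at hk; exact lt_of_mul_lt_mul_left hk hr.le), zero_pow hr.ne']
  · exact steenrod_pow_char_pow_of_not_dvd h f

theorem SteenrodInert.steenrod_left_mul {c d : ℕ} {f : MvPolynomial (Fin n) (ZMod p)}
    (hf : SteenrodInert p n d f) (h : c < d) (g : MvPolynomial (Fin n) (ZMod p)) :
    steenrod p n (p ^ c) (f * g) = f * steenrod p n (p ^ c) g := by
  have hcd : p ^ c < p ^ d := Nat.pow_lt_pow_right (Fact.out : p.Prime).one_lt h
  rw [_root_.steenrod_mul, Finset.sum_eq_single (0, p ^ c)]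
  · rw [steenrod_zero_left]
  · rintro ⟨a, b⟩ hx hx'
    rw [Finset.HasAntidiagonal.mem_antidiagonal] at hx
    simp only [ne_eq, Prod.mk.injEq, not_and] at hx' hx
    rw [hf a (by omega) (by omega), zero_mul]
  · simp

theorem steenrodList_append (l₁ l₂ : List ℕ) (f : MvPolynomial (Fin n) (ZMod p)) :
    steenrodList p n (l₁ ++ l₂) f = steenrodList p n l₁ (steenrodList p n l₂ f) := by
  induction l₁ with
  | nil => rfl
  | cons s l ih => simp only [List.cons_append, steenrodList, ih]

theorem steenrodList_add (l : List ℕ) (f g : MvPolynomial (Fin n) (ZMod p)) :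
    steenrodList p n l (f + g) = steenrodList p n l f + steenrodList p n l g := by
  induction l with
  | nil => rfl
  | cons s l ih => simp only [steenrodList, ih, steenrod_add]

theorem steenrodList_smul (l : List ℕ) (a : ZMod p) (f : MvPolynomial (Fin n) (ZMod p)) :
    steenrodList p n l (a • f) = a • steenrodList p n l f := by
  induction l with
  | nil => rfl
  | cons s l ih => simp only [steenrodList, ih, steenrod_smul]

theorem steenrodList_range'_succ (r k : ℕ) (f : MvPolynomial (Fin n) (ZMod p)) :
    steenrodList p n (List.range' r (k + 1)) f =
      steenrodList p n (List.range' r k) (steenrod p n (p ^ (r + k)) f) := by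
  rw [List.range'_concat, steenrodList_append]
  simp [steenrodList]

theorem SteenrodInert.steenrodList_left_mul {d : ℕ} {f : MvPolynomial (Fin n) (ZMod p)}
    (hf : SteenrodInert p n d f) {l : List ℕ} (hl : ∀ c ∈ l, c < d)
    (g : MvPolynomial (Fin n) (ZMod p)) :
    steenrodList p n l (f * g) = f * steenrodList p n l g := by
  induction l with
  | nil => rfl
  | cons s l ih =>
    rw [List.forall_mem_cons] at hl
    simp only [steenrodList, ih hl.2, hf.steenrod_left_mul hl.1]

theorem steenrodList_range'_pow_char_pow (r k : ℕ) (f : MvPolynomial (Fin n) (ZMod p)) :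
    steenrodList p n (List.range' r (k + 1)) (f ^ p ^ (r + 1)) = 0 := by
  have h (l : List ℕ) : ∃ g, steenrodList p n l (f ^ p ^ (r + 1)) = g ^ p ^ (r + 1) := by
    induction l with
    | nil => exact ⟨f, rfl⟩
    | cons s l ih =>
      obtain ⟨g, hg⟩ := ih
      obtain ⟨g', hg'⟩ := exists_steenrod_pow_char_pow (r + 1) (p ^ s) g
      exact ⟨g', by simp only [steenrodList, hg, hg']⟩
  obtain ⟨g, hg⟩ := h (List.range' (r + 1) k)
  rw [List.range'_succ]
  simp only [steenrodList]
  rw [hg, steenrod_pow_char_pow_of_not_dvd]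
  exact Nat.not_dvd_of_pos_of_lt (pow_pos (Fact.out : p.Prime).pos r)
    (Nat.pow_lt_pow_right (Fact.out : p.Prime).one_lt r.lt_succ_self)

/-- If `f` is carried to `h * g` by the first operation of a chain, and the chain kills the
derivative of the cofactor `G`, the chain acts on `f * G` through `g` alone. -/
theorem steenrodList_range'_mul {r k : ℕ} {f h g G : MvPolynomial (Fin n) (ZMod p)}
    (hf : SteenrodInert p n (r + k) f) (hh : SteenrodInert p n (r + k) h)
    (hfg : steenrod p n (p ^ (r + k)) f = h * g) (hG : SteenrodInert p n (r + k) G)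
    (hG0 : steenrodList p n (List.range' r (k + 1)) G = 0) :
    steenrodList p n (List.range' r (k + 1)) (f * G) =
      h * G * steenrodList p n (List.range' r k) g := by
  have hl : ∀ c ∈ List.range' r k, c < r + k := fun c hc => by
    rw [List.mem_range'_1] at hc; exact hc.2
  rw [steenrodList_range'_succ] at hG0 ⊢
  rw [hf.steenrod_mul, hfg, steenrodList_add, hf.steenrodList_left_mul hl, hG0, mul_zero,
    add_zero, mul_right_comm, (hh.mul hG).steenrodList_left_mul hl]

theorem steenrodList_range'_prod {ι : Type*} (s : Finset ι)
    (f : ι → MvPolynomial (Fin n) (ZMod p)) {r k : ℕ}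
    (hf : ∀ i ∈ s, SteenrodInert p n (r + k) (f i))
    (hf0 : ∀ i ∈ s, steenrodList p n (List.range' r (k + 1)) (f i) = 0) :
    steenrodList p n (List.range' r (k + 1)) (∏ i ∈ s, f i) = 0 := by
  have hl : ∀ c ∈ List.range' r k, c < r + k := fun c hc => by
    rw [List.mem_range'_1] at hc; exact hc.2
  simp only [steenrodList_range'_succ] at hf0 ⊢
  refine (Finset.prod_induction f (fun g => SteenrodInert p n (r + k) g ∧
    steenrodList p n (List.range' r k) (steenrod p n (p ^ (r + k)) g) = 0) ?_ ?_
    fun i hi => ⟨hf i hi, hf0 i hi⟩).2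
  · rintro a b ⟨ha, ha0⟩ ⟨hb, hb0⟩
    refine ⟨ha.mul hb, ?_⟩
    rw [ha.steenrod_mul, steenrodList_add, mul_comm _ b, hb.steenrodList_left_mul hl,
      ha.steenrodList_left_mul hl, ha0, hb0, mul_zero, mul_zero, add_zero]
  · refine ⟨steenrodInert_one _, ?_⟩
    rw [← steenrodList_range'_succ]
    simpa using steenrodList_range'_pow_char_pow r k (1 : MvPolynomial (Fin n) (ZMod p))

theorem steenrodInert_prod {ι : Type*} (s : Finset ι)
    (f : ι → MvPolynomial (Fin n) (ZMod p)) {c : ℕ} (hf : ∀ i ∈ s, SteenrodInert p n c (f i)) :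
    SteenrodInert p n c (∏ i ∈ s, f i) :=
  Finset.prod_induction f (SteenrodInert p n c) (fun _ _ => SteenrodInert.mul)
    (steenrodInert_one c) hf

theorem steenrodList_of_inert {r k : ℕ} {f : MvPolynomial (Fin n) (ZMod p)}
    (hf : SteenrodInert p n (r + k + 1) f) :
    steenrodList p n (List.range' r (k + 1)) f = 0 := by
  rw [steenrodList_range'_succ, hf.steenrod_eq_zero (Nat.lt_succ_self _)]
  simpa using steenrodList_smul (List.range' r k) (0 : ZMod p)
    (0 : MvPolynomial (Fin n) (ZMod p))

theorem exists_Pt_dickson_of_pos (hn : 0 < n) :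
    ∃ a : Polynomial (MvPolynomial (Fin n) (ZMod p)),
      a.coeff 0 = 1 ∧ (∀ k, 0 < k → k < p ^ (n - 1) → a.coeff k = 0) ∧
      a.coeff (p ^ (n - 1)) = - dickson p n 1 ∧
      Pt p n (dickson p n n) = a * Polynomial.C (dickson p n n) ∧
      ∀ i < n, Pt p n (dickson p n i) =
          Polynomial.X ^ p ^ (n - i - 1) * Pt p n (dickson p n (i + 1)) +
        a * Polynomial.C (dickson p n i) -
          Polynomial.X ^ p ^ n * Polynomial.C (dickson p n (i + 1) ^ p) := by
  have hp := (Fact.out : p.Prime)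
  obtain ⟨a, ha, hi⟩ := exists_Pt_dickson p n
  have h0 := hi 0 hn
  rw [dickson_zero] at h0
  have ha0 : a = 1 - Polynomial.X ^ p ^ (n - 1) * Pt p n (dickson p n 1) +
      Polynomial.X ^ p ^ n * Polynomial.C (dickson p n 1 ^ p) := by
    simp only [map_one, mul_one, Nat.sub_zero, Nat.zero_add] at h0
    linear_combination - h0
  have hlt : p ^ (n - 1) < p ^ n := Nat.pow_lt_pow_right hp.one_lt (by omega)
  have hpos : 0 < p ^ (n - 1) := pow_pos hp.pos _
  refine ⟨a, ?_, ?_, ?_, ha, fun i h => by linear_combination hi i h⟩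
  · simp [ha0, (hpos.trans hlt).ne, hpos.ne]
  · intro k h1 h2
    simp [ha0, Polynomial.coeff_X_pow_mul', Polynomial.coeff_one, h1.ne', h2.not_ge,
      (h2.trans hlt).not_ge]
  · have := steenrod_zero_left (dickson p n 1)
    rw [steenrod] at this
    simp [ha0, Polynomial.coeff_X_pow_mul', Polynomial.coeff_one, hp.ne_zero, hlt.not_ge, this]

theorem steenrodInert_dickson_self (hn : 0 < n) : SteenrodInert p n (n - 1) (dickson p n n) := by
  obtain ⟨a, -, h, -, ha, -⟩ := exists_Pt_dickson_of_pos (p := p) hn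
  intro k h0 hk
  rw [steenrod, ha, Polynomial.coeff_mul_C, h k h0 hk, zero_mul]

theorem steenrod_dickson_self (hn : 0 < n) :
    steenrod p n (p ^ (n - 1)) (dickson p n n) = - dickson p n n * dickson p n 1 := by
  obtain ⟨a, -, -, h, ha, -⟩ := exists_Pt_dickson_of_pos (p := p) hn
  rw [steenrod, ha, Polynomial.coeff_mul_C, h]
  ring

theorem steenrodInert_dickson {i : ℕ} (hi : 0 < i) (hin : i < n) :
    SteenrodInert p n (n - i - 1) (dickson p n i) := by
  have hp := (Fact.out : p.Prime)
  obtain ⟨a, -, h, -, -, ha⟩ := exists_Pt_dickson_of_pos (p := p) (hi.trans hin)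
  intro k h0 hk
  have h1 : p ^ (n - i - 1) < p ^ (n - 1) := Nat.pow_lt_pow_right hp.one_lt (by omega)
  have h2 : p ^ (n - 1) < p ^ n := Nat.pow_lt_pow_right hp.one_lt (by omega)
  rw [steenrod, ha i hin, Polynomial.coeff_sub, Polynomial.coeff_add, Polynomial.coeff_mul_C,
    Polynomial.coeff_X_pow_mul', Polynomial.coeff_X_pow_mul', h k h0 (by omega), if_neg (by omega),
    if_neg (by omega)]
  ring

theorem steenrod_dickson {i : ℕ} (hi : 0 < i) (hin : i < n) :
    steenrod p n (p ^ (n - i - 1)) (dickson p n i) = dickson p n (i + 1) := by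
  have hp := (Fact.out : p.Prime)
  obtain ⟨a, -, h, -, -, ha⟩ := exists_Pt_dickson_of_pos (p := p) (hi.trans hin)
  have h1 : p ^ (n - i - 1) < p ^ (n - 1) := Nat.pow_lt_pow_right hp.one_lt (by omega)
  have h2 : p ^ (n - 1) < p ^ n := Nat.pow_lt_pow_right hp.one_lt (by omega)
  have h3 := steenrod_zero_left (dickson p n (i + 1))
  rw [steenrod] at h3
  rw [steenrod, ha i hin, Polynomial.coeff_sub, Polynomial.coeff_add, Polynomial.coeff_mul_C,
    Polynomial.coeff_X_pow_mul', Polynomial.coeff_X_pow_mul', h _ (pow_pos hp.pos _) h1,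
    if_pos le_rfl, if_neg (by omega), Nat.sub_self, h3]
  ring

theorem steenrodInert_dickson_pow {i c k : ℕ} (hi : 0 < i) (hin : i < n)
    (h : p ^ (c + 1 + i - n) ∣ k) : SteenrodInert p n c (dickson p n i ^ k) := by
  obtain ⟨m, rfl⟩ := h
  rw [pow_mul]
  exact (((steenrodInert_dickson hi hin).pow_char_pow _).mono (by omega)).pow m

theorem steenrodInert_dickson_self_pow {c k : ℕ} (hn : 0 < n)
    (h : p ^ (c + 1 - n) ∣ k) : SteenrodInert p n c (dickson p n n ^ k) := by
  obtain ⟨m, rfl⟩ := h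
  rw [pow_mul]
  exact (((steenrodInert_dickson_self hn).pow_char_pow _).mono (by omega)).pow m

theorem steenrodList_dickson_pow_char_pow {r k i : ℕ} (hi : 0 < i) (hik : i + k = n) :
    steenrodList p n (List.range' r k) (dickson p n i ^ p ^ r) = dickson p n n ^ p ^ r := by
  induction k generalizing i with
  | zero => simp at hik; simp [hik, steenrodList]
  | succ k ih =>
    have hk : k = n - i - 1 := by omega
    rw [steenrodList_range'_succ, add_comm r k, pow_add, steenrod_pow_char_pow_mul, hk,
      steenrod_dickson hi (by omega), ← hk]
    exact ih (Nat.succ_pos i) (by omega)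

/-- A factor which is a `p ^ (r + 1)`-st power or sufficiently inert is killed by the chain. -/
theorem steenrodList_range'_dickson_pow {r k j e : ℕ} (hj : 0 < j) (hjn : j < n)
    (h : p ^ (r + 1) ∣ e ∨ p ^ (r + k + 2 + j - n) ∣ e) :
    steenrodList p n (List.range' r (k + 1)) (dickson p n j ^ e) = 0 := by
  rcases h with ⟨m, rfl⟩ | h
  · rw [mul_comm, pow_mul]
    exact steenrodList_range'_pow_char_pow r k _
  · exact steenrodList_of_inert (steenrodInert_dickson_pow hj hjn h)

theorem steenrodList_raise_top {c e m : ℕ} {K : ℕ → ℕ} (hn : 0 < n)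
    (hK : ∀ j ∈ Finset.Ico 1 n, p ^ (c + 1 + j - n) ∣ K j) (he : e + n ≤ c + 1) :
    steenrodList p n (List.range' e n)
        (dickson p n n ^ (p ^ e * (m + 1)) * ∏ j ∈ Finset.Ico 1 n, dickson p n j ^ K j) =
      (-(m + 1 : ℕ) : ZMod p) • (dickson p n n ^ (p ^ e * (m + 2)) *
        ∏ j ∈ Finset.Ico 1 n, dickson p n j ^ K j) := by
  have hp := (Fact.out : p.Prime)
  obtain ⟨k, rfl⟩ : ∃ k, n = k + 1 := ⟨n - 1, by omega⟩
  have hd := (steenrodInert_dickson_self (p := p) hn).pow_char_pow e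
  rw [Nat.add_sub_cancel] at hd
  have hstep : steenrod p (k + 1) (p ^ (e + k)) (dickson p (k + 1) (k + 1) ^ p ^ e) =
      - (dickson p (k + 1) (k + 1) ^ p ^ e * dickson p (k + 1) 1 ^ p ^ e) := by
    have := steenrod_dickson_self (p := p) hn
    rw [Nat.add_sub_cancel] at this
    rw [add_comm e k, pow_add, steenrod_pow_char_pow_mul, this, mul_pow, neg_pow, neg_one_pow_char_pow]
    ring
  have hG : ∀ j ∈ Finset.Ico 1 (k + 1),
      SteenrodInert p (k + 1) (e + k) (dickson p (k + 1) j ^ K j) := fun j hj => by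
    have hj' := Finset.mem_Ico.mp hj
    exact steenrodInert_dickson_pow hj'.1 hj'.2
      ((pow_dvd_pow p (by omega)).trans (hK j hj))
  have hG0 : ∀ j ∈ Finset.Ico 1 (k + 1), steenrodList p (k + 1) (List.range' e (k + 1))
      (dickson p (k + 1) j ^ K j) = 0 := fun j hj => by
    have hj' := Finset.mem_Ico.mp hj
    exact steenrodList_range'_dickson_pow hj'.1 hj'.2
      (Or.inl ((pow_dvd_pow p (by omega)).trans (hK j hj)))
  rw [pow_mul, steenrodList_range'_mul (hd.pow _)
    (h := (-(m + 1 : ℕ) : ZMod p) • (dickson p (k + 1) (k + 1) ^ p ^ e) ^ (m + 1))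
    (g := dickson p (k + 1) 1 ^ p ^ e) ((hd.pow _).smul _) ?_ (steenrodInert_prod _ _ hG)
    (steenrodList_range'_prod _ _ hG hG0),
    steenrodList_dickson_pow_char_pow one_pos (add_comm _ _)]
  · rw [smul_mul_assoc, smul_mul_assoc]
    congr 1
    ring
  · rw [hd.steenrod_pow, hstep, neg_smul, neg_mul, smul_mul_assoc, mul_neg, smul_neg]
    congr 2
    ring

theorem exists_steenrodList_raise_top {c : ℕ} {K : ℕ → ℕ} (hn : 0 < n)
    (hK : ∀ j ∈ Finset.Ico 1 n, p ^ (c + 1 + j - n) ∣ K j) (e k : ℕ) (he : e + n ≤ c + 2 ∨ e = 0) :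
    ∃ (s : List ℕ) (N : ℕ) (u : (ZMod p)ˣ), k ≤ N ∧ p ^ e ∣ N ∧
      steenrodList p n s
          (dickson p n n ^ k * ∏ j ∈ Finset.Ico 1 n, dickson p n j ^ K j) =
        (u : ZMod p) • (dickson p n n ^ N * ∏ j ∈ Finset.Ico 1 n, dickson p n j ^ K j) := by
  have hp := (Fact.out : p.Prime)
  induction e with
  | zero => exact ⟨[], k, 1, le_rfl, by simp, by simp [steenrodList]⟩
  | succ e ih =>
    obtain ⟨s, N, u, hN, ⟨m, rfl⟩, hs⟩ := ih (by omega)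
    have key : ∀ a m : ℕ, p ∣ m + a → ∃ (s : List ℕ) (M : ℕ) (u : (ZMod p)ˣ), m ≤ M ∧ p ∣ M ∧
        steenrodList p n s
            (dickson p n n ^ (p ^ e * m) * ∏ j ∈ Finset.Ico 1 n, dickson p n j ^ K j) =
          (u : ZMod p) •
            (dickson p n n ^ (p ^ e * M) * ∏ j ∈ Finset.Ico 1 n, dickson p n j ^ K j) := by
      intro a
      induction a with
      | zero => exact fun m hm => ⟨[], m, 1, le_rfl, hm, by simp [steenrodList]⟩
      | succ a iha =>
        intro m hm
        by_cases hpm : p ∣ m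
        · exact ⟨[], m, 1, le_rfl, hpm, by simp [steenrodList]⟩
        · obtain ⟨l, rfl⟩ : ∃ l, m = l + 1 := Nat.exists_eq_succ_of_ne_zero (by
            rintro rfl; exact hpm (dvd_zero p))
          obtain ⟨s, M, u, hM, hpM, hs⟩ := iha (l + 2) (by
            rwa [show l + 2 + a = l + 1 + (a + 1) by ring])
          have hl : (-(l + 1 : ℕ) : ZMod p) ≠ 0 := by
            rwa [neg_ne_zero, Ne, ZMod.natCast_eq_zero_iff]
          refine ⟨s ++ List.range' e n, M, Units.mk0 _ hl * u, by omega, hpM, ?_⟩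
          rw [steenrodList_append, steenrodList_raise_top hn hK (by omega), steenrodList_smul, hs,
            smul_smul]
          rfl
    obtain ⟨a, ha⟩ : ∃ a, p ∣ m + a := ⟨(p - 1) * m, by
      have := hp.pos
      exact ⟨m, by obtain ⟨q, rfl⟩ : ∃ q, p = q + 1 := ⟨p - 1, by omega⟩
                   simp only [Nat.add_sub_cancel]; ring⟩⟩
    obtain ⟨s', M, u', hM, hpM, hs'⟩ := key a m ha
    refine ⟨s' ++ s, p ^ e * M, u * u', hN.trans (Nat.mul_le_mul_left _ hM), ?_, ?_⟩
    · rw [pow_succ]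
      exact Nat.mul_dvd_mul_left _ hpM
    · rw [steenrodList_append, hs, steenrodList_smul, hs', smul_smul]
      rfl

theorem steenrodList_lower {i r m : ℕ} {K : ℕ → ℕ} {N : ℕ} (hi : 0 < i) (hin : i < n)
    (hKi : K i = p ^ r * (m + 1))
    (hK : ∀ j ∈ Finset.Ico 1 n, p ^ (r + (n - i - 1) + 1 + j - n) ∣ K j)
    (hK' : ∀ j ∈ (Finset.Ico 1 n).erase i,
      p ^ (r + 1) ∣ K j ∨ p ^ (r + (n - i - 1) + 2 + j - n) ∣ K j)
    (hN : p ^ (r + (n - i - 1) + 2 - n) ∣ N) :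
    steenrodList p n (List.range' r (n - i - 1 + 1))
        (dickson p n n ^ N * ∏ j ∈ Finset.Ico 1 n, dickson p n j ^ K j) =
      ((m + 1 : ℕ) : ZMod p) • (dickson p n n ^ (N + p ^ r) *
        (dickson p n i ^ (p ^ r * m) * ∏ j ∈ (Finset.Ico 1 n).erase i, dickson p n j ^ K j)) := by
  have hmem : i ∈ Finset.Ico 1 n := Finset.mem_Ico.mpr ⟨hi, hin⟩
  set k := n - i - 1 with hk
  have hd := (steenrodInert_dickson (p := p) hi hin).pow_char_pow r
  rw [← hk] at hd
  have hstep : steenrod p n (p ^ (r + k)) (dickson p n i ^ p ^ r) =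
      dickson p n (i + 1) ^ p ^ r := by
    rw [add_comm r k, pow_add, steenrod_pow_char_pow_mul, hk, steenrod_dickson hi hin]
  have hT : SteenrodInert p n (r + k + 1) (dickson p n n ^ N) :=
    steenrodInert_dickson_self_pow (hi.trans hin) hN
  have hG : ∀ j ∈ (Finset.Ico 1 n).erase i,
      SteenrodInert p n (r + k) (dickson p n j ^ K j) := fun j hj => by
    have hj' := Finset.mem_Ico.mp (Finset.mem_of_mem_erase hj)
    exact steenrodInert_dickson_pow hj'.1 hj'.2 (hK j (Finset.mem_of_mem_erase hj))
  have hG0 : ∀ j ∈ (Finset.Ico 1 n).erase i, steenrodList p n (List.range' r (k + 1))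
      (dickson p n j ^ K j) = 0 := fun j hj => by
    have hj' := Finset.mem_Ico.mp (Finset.mem_of_mem_erase hj)
    exact steenrodList_range'_dickson_pow hj'.1 hj'.2 (hK' j hj)
  have hl : ∀ c ∈ List.range' r (k + 1), c < r + k + 1 := fun c hc => by
    rw [List.mem_range'_1] at hc; exact hc.2
  rw [hT.steenrodList_left_mul hl, ← Finset.mul_prod_erase _ _ hmem, hKi, pow_mul,
    steenrodList_range'_mul (hd.pow _)
    (h := ((m + 1 : ℕ) : ZMod p) • (dickson p n i ^ p ^ r) ^ m)
    (g := dickson p n (i + 1) ^ p ^ r) ((hd.pow _).smul _) ?_ (steenrodInert_prod _ _ hG)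
    (steenrodList_range'_prod _ _ hG hG0),
    steenrodList_dickson_pow_char_pow (Nat.succ_pos i) (by omega)]
  · rw [smul_mul_assoc, smul_mul_assoc, mul_smul_comm]
    congr 1
    ring
  · rw [hd.steenrod_pow, hstep, smul_mul_assoc]

end SteenrodOperations

/-- Corollary: if `K = (k(1),...,k(n))` has `k(1) + ⋯ + k(n-1) > 0`, then some finite
composite of operations `P^{p^s}` carries `d^K` to a unit multiple of a monomial `d^L` with
`l(n) > k(n)`, `l(i) < k(i)` for some `i < n`, and `l(t) = k(t)` for all other `t`. -/
theorem exists_steenrod_raising (p n : ℕ) [Fact p.Prime] (K : ℕ → ℕ)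
    (hK : 0 < ∑ i ∈ Finset.Ico 1 n, K i) :
    ∃ (s : List ℕ) (L : ℕ → ℕ) (u : (ZMod p)ˣ) (i₀ : ℕ),
      steenrodList p n s (∏ i ∈ Finset.Icc 1 n, dickson p n i ^ K i) =
        (u : ZMod p) • ∏ i ∈ Finset.Icc 1 n, dickson p n i ^ L i ∧
      K n < L n ∧
      1 ≤ i₀ ∧ i₀ < n ∧ L i₀ < K i₀ ∧
      ∀ t, 1 ≤ t → t ≤ n → t ≠ i₀ → t ≠ n → L t = K t := by
  have hp := (Fact.out : p.Prime)
  have hne : ((Finset.Ico 1 n).filter fun j => K j ≠ 0).Nonempty := by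
    obtain ⟨j, hj, hj0⟩ := Finset.exists_ne_zero_of_sum_ne_zero hK.ne'
    exact ⟨j, Finset.mem_filter.mpr ⟨hj, hj0⟩⟩
  obtain ⟨i, hi, hmin⟩ := Finset.exists_min_image _
    (fun j => toLex (padicValNat p (K j) + (n - j - 1), j)) hne
  obtain ⟨hi1, hKi⟩ := Finset.mem_filter.mp hi
  obtain ⟨hi0, hin⟩ := Finset.mem_Ico.mp hi1
  set r := padicValNat p (K i) with hr
  have hmin' : ∀ j, 1 ≤ j → j < n → K j ≠ 0 →
      r + (n - i - 1) < padicValNat p (K j) + (n - j - 1) ∨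
      r + (n - i - 1) = padicValNat p (K j) + (n - j - 1) ∧ i ≤ j := fun j h1 h2 h3 =>
    Prod.Lex.toLex_le_toLex.mp
      (hmin j (Finset.mem_filter.mpr ⟨Finset.mem_Ico.mpr ⟨h1, h2⟩, h3⟩))
  have hdvd : ∀ a j, a ≤ padicValNat p (K j) → p ^ a ∣ K j := fun a j h =>
    (pow_dvd_pow p h).trans pow_padicValNat_dvd
  obtain ⟨m', hm'⟩ : p ^ r ∣ K i := pow_padicValNat_dvd
  have hpm : ¬ p ∣ m' := by
    rintro ⟨q, rfl⟩
    exact pow_succ_padicValNat_not_dvd hKi ⟨q, by rw [← hr, hm', pow_succ, mul_assoc]⟩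
  obtain ⟨m, rfl⟩ : ∃ m, m' = m + 1 := Nat.exists_eq_succ_of_ne_zero (by
    rintro rfl; exact hpm (dvd_zero p))
  have hA : ∀ j ∈ Finset.Ico 1 n, p ^ (r + (n - i - 1) + 1 + j - n) ∣ K j := fun j hj => by
    obtain ⟨h1, h2⟩ := Finset.mem_Ico.mp hj
    by_cases h3 : K j = 0
    · simp [h3]
    · have := hmin' j h1 h2 h3
      exact hdvd _ _ (by omega)
  have hB : ∀ j ∈ (Finset.Ico 1 n).erase i,
      p ^ (r + 1) ∣ K j ∨ p ^ (r + (n - i - 1) + 2 + j - n) ∣ K j := fun j hj => by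
    obtain ⟨hji, hj⟩ := Finset.mem_erase.mp hj
    obtain ⟨h1, h2⟩ := Finset.mem_Ico.mp hj
    by_cases h3 : K j = 0
    · simp [h3]
    · rcases hmin' j h1 h2 h3 with h | h
      · exact Or.inr (hdvd _ _ (by omega))
      · exact Or.inl (hdvd _ _ (by omega))
  obtain ⟨s, N, u, hN, hpN, hs⟩ := exists_steenrodList_raise_top (by omega) hA
    (r + (n - i - 1) + 2 - n) (K n) (by omega)
  have hu : ((m + 1 : ℕ) : ZMod p) ≠ 0 := by rwa [Ne, ZMod.natCast_eq_zero_iff]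
  have hsplit (L : ℕ → ℕ) : ∏ j ∈ Finset.Icc 1 n, dickson p n j ^ L j =
      dickson p n n ^ L n * ∏ j ∈ Finset.Ico 1 n, dickson p n j ^ L j := by
    rw [← Finset.Ico_insert_right (by omega), Finset.prod_insert (by simp)]
  have hpr : 0 < p ^ r := pow_pos hp.pos r
  refine ⟨List.range' r (n - i - 1 + 1) ++ s,
    Function.update (Function.update K i (p ^ r * m)) n (N + p ^ r), u * Units.mk0 _ hu, i,
    ?_, ?_, hi0, hin, ?_, ?_⟩
  · rw [steenrodList_append, hsplit, hs, steenrodList_smul, steenrodList_lower hi0 hin hm' hA hB hpN,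
      smul_smul, hsplit, ← Finset.mul_prod_erase (Finset.Ico 1 n) _ hi1]
    simp only [Function.update_self, Function.update_of_ne hin.ne]
    congr 3
    refine Finset.prod_congr rfl fun j hj => ?_
    obtain ⟨hji, hj⟩ := Finset.mem_erase.mp hj
    rw [Function.update_of_ne (Finset.mem_Ico.mp hj).2.ne, Function.update_of_ne hji]
  · rw [Function.update_self]
    omega
  · rw [Function.update_of_ne hin.ne, Function.update_self, hm']
    exact Nat.mul_lt_mul_of_pos_left m.lt_succ_self hpr
  · intro t _ _ hti htn
    rw [Function.update_of_ne htn, Function.update_of_ne hti]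
end

section
/- Mui's computation of the upper-triangular invariants for p = 2, n = 2: the subalgebra of F_2[y_1,y_2] invariant under the group U_2 = { (1 a; 0 1) : a ∈ F_2 } of upper triangular unipotent matrices (acting by linear substitution of the variables) is the polynomial algebra F_2[h_1, h_2] on the algebraically independent elements h_1 = y_1 and h_2 = y_2^2 + y_2 y_1. -/
open MvPolynomial

/-- `R[y_1, y_2]` is generated as a module over `R[y_1, y_2^2 + y_2 y_1]` by `1` and `y_2`. -/
lemma exists_eq_add_mul_X_one {R : Type*} [CommRing R] (f : MvPolynomial (Fin 2) R) :
    ∃ p ∈ Algebra.adjoin R {(X 0 : MvPolynomial (Fin 2) R), X 1 ^ 2 + X 1 * X 0},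
      ∃ q ∈ Algebra.adjoin R {(X 0 : MvPolynomial (Fin 2) R), X 1 ^ 2 + X 1 * X 0},
        f = p + q * X 1 := by
  set A := Algebra.adjoin R {(X 0 : MvPolynomial (Fin 2) R), X 1 ^ 2 + X 1 * X 0}
  have h₁ : X 0 ∈ A := Algebra.subset_adjoin (by simp)
  have h₂ : X 1 ^ 2 + X 1 * X 0 ∈ A := Algebra.subset_adjoin (by simp)
  induction f using MvPolynomial.induction_on with
  | C a => exact ⟨C a, A.algebraMap_mem a, 0, A.zero_mem, by simp⟩
  | add f g hf hg =>
    obtain ⟨p, hp, q, hq, rfl⟩ := hf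
    obtain ⟨p', hp', q', hq', rfl⟩ := hg
    exact ⟨p + p', A.add_mem hp hp', q + q', A.add_mem hq hq', by ring⟩
  | mul_X f i hf =>
    obtain ⟨p, hp, q, hq, rfl⟩ := hf
    fin_cases i
    · exact ⟨p * X 0, A.mul_mem hp h₁, q * X 0, A.mul_mem hq h₁, by simp only [Fin.zero_eta]; ring⟩
    · exact ⟨q * (X 1 ^ 2 + X 1 * X 0), A.mul_mem hq h₂, p - q * X 0,
        A.sub_mem hp (A.mul_mem hq h₁), by simp only [Fin.mk_one]; ring⟩

lemma isIntegral_adjoin_X_zero_X_one_sq_add {R : Type*} [CommRing R] :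
    Algebra.IsIntegral
      (Algebra.adjoin R {(X 0 : MvPolynomial (Fin 2) R), X 1 ^ 2 + X 1 * X 0})
      (MvPolynomial (Fin 2) R) := by
  set A := Algebra.adjoin R {(X 0 : MvPolynomial (Fin 2) R), X 1 ^ 2 + X 1 * X 0}
  have h₁ : X 0 ∈ A := Algebra.subset_adjoin (by simp)
  have h₂ : X 1 ^ 2 + X 1 * X 0 ∈ A := Algebra.subset_adjoin (by simp)
  have hX : IsIntegral A (X 1 : MvPolynomial (Fin 2) R) := by
    refine ⟨.X ^ 2 + (.C ⟨X 0, h₁⟩ * .X - .C ⟨_, h₂⟩), ?_, ?_⟩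
    · exact Polynomial.monic_X_pow_add (by compute_degree!)
    · simp
      ring
  refine ⟨fun f ↦ ?_⟩
  obtain ⟨p, hp, q, hq, rfl⟩ := exists_eq_add_mul_X_one f
  exact (isIntegral_algebraMap (x := (⟨p, hp⟩ : A))).add
    ((isIntegral_algebraMap (x := (⟨q, hq⟩ : A))).mul hX)

lemma algebraicIndependent_X_zero_X_one_sq_add {R : Type*} [CommRing R] [IsDomain R] :
    AlgebraicIndependent R ![(X 0 : MvPolynomial (Fin 2) R), X 1 ^ 2 + X 1 * X 0] := by
  have : Algebra.IsAlgebraic (Algebra.adjoin R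
      (Set.range ![(X 0 : MvPolynomial (Fin 2) R), X 1 ^ 2 + X 1 * X 0]))
      (MvPolynomial (Fin 2) R) := by
    rw [Matrix.range_cons_cons_empty]
    have := isIntegral_adjoin_X_zero_X_one_sq_add (R := R)
    infer_instance
  exact (Algebra.IsAlgebraic.isTranscendenceBasis_of_lift_le_trdeg_of_finite R _
    (by simp [MvPolynomial.trdeg_of_isDomain])).1

/-- The substitution `y_2 ↦ y_2 + a y_1` with `a ^ 2 = -a` and `2 a = 0` fixes
`R[y_1, y_2^2 + y_2 y_1]` pointwise. -/
lemma aeval_eq_self_of_mem_adjoin {R : Type*} [CommRing R] {a : R} (ha : a ^ 2 = -a)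
    (ha' : 2 * a = 0) {f : MvPolynomial (Fin 2) R}
    (hf : f ∈ Algebra.adjoin R {(X 0 : MvPolynomial (Fin 2) R), X 1 ^ 2 + X 1 * X 0}) :
    aeval ![(X 0 : MvPolynomial (Fin 2) R), X 1 + C a * X 0] f = f := by
  have hC : (C a : MvPolynomial (Fin 2) R) ^ 2 = -C a := by rw [← C_pow, ha, C_neg]
  have hC' : 2 * (C a : MvPolynomial (Fin 2) R) = 0 := by
    rw [two_mul, ← C_add, ← two_mul, ha', C_0]
  suffices Algebra.adjoin R {(X 0 : MvPolynomial (Fin 2) R), X 1 ^ 2 + X 1 * X 0} ≤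
      AlgHom.equalizer (aeval ![(X 0 : MvPolynomial (Fin 2) R), X 1 + C a * X 0])
        (AlgHom.id R _) from this hf
  rw [Algebra.adjoin_le_iff]
  rintro _ (rfl | rfl)
  · simp
  · simp only [SetLike.mem_coe, AlgHom.mem_equalizer, map_add, map_mul, map_pow, aeval_X,
      Matrix.cons_val_zero, Matrix.cons_val_one, AlgHom.id_apply]
    linear_combination X 0 ^ 2 * hC + X 0 * X 1 * hC'

/-- Mui's computation of the upper-triangular invariants for `p = 2`, `n = 2`: the subalgebra
of `F_2[y_1, y_2]` invariant under `U_2 = {(1 a; 0 1) : a ∈ F_2}` (acting by the linear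
substitutions `y_1 ↦ y_1`, `y_2 ↦ y_2 + a·y_1`) is the polynomial algebra on the
algebraically independent elements `h_1 = y_1` and `h_2 = y_2^2 + y_2·y_1`. -/
theorem upper_triangular_invariants_two :
    AlgebraicIndependent (ZMod 2)
      ![(X 0 : MvPolynomial (Fin 2) (ZMod 2)), X 1 ^ 2 + X 1 * X 0] ∧
    ∀ f : MvPolynomial (Fin 2) (ZMod 2),
      f ∈ Algebra.adjoin (ZMod 2)
          {(X 0 : MvPolynomial (Fin 2) (ZMod 2)), X 1 ^ 2 + X 1 * X 0} ↔
        ∀ a : ZMod 2, aeval ![(X 0 : MvPolynomial (Fin 2) (ZMod 2)), X 1 + C a * X 0] f = f := by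
  refine ⟨algebraicIndependent_X_zero_X_one_sq_add, fun f ↦ ⟨fun hf a ↦ ?_, fun hf ↦ ?_⟩⟩
  · exact aeval_eq_self_of_mem_adjoin (by decide +revert) (by decide +revert) hf
  · obtain ⟨p, hp, q, hq, rfl⟩ := exists_eq_add_mul_X_one f
    have h := hf 1
    rw [map_add, map_mul, aeval_eq_self_of_mem_adjoin (by decide) (by decide) hp,
      aeval_eq_self_of_mem_adjoin (by decide) (by decide) hq, aeval_X] at h
    simp only [Matrix.cons_val_one, Matrix.cons_val_fin_one, C_1] at h
    have hq0 : q * X 0 = 0 := by linear_combination h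
    obtain rfl : q = 0 := (mul_eq_zero.mp hq0).resolve_right (X_ne_zero 0)
    simpa using hp
end
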